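/- arXiv:1710.05430 — 2 statements merged into one kernel-verified Lean document; each statement's English description precedes it below -/
import Mathlib

section
/- There exist K ≥ 10, n₀ ∈ ℕ with n₀ ≥ 1, and C > 0, all depending only on the Schottky data, such that for every h ∈ (0,1], every ν ∈ [0,1/2], setting s := 1/2 − ν + i/h, and every function f continuous on D and holomorphic on the interior of D: sup over z ∈ D of e^{−K|Im z|/h} |(L_s^{n₀} f)(z)| ≤ C · sup over z ∈ D₂ of e^{−K|Im z|/h} |f(z)|, where L_s^{n₀} is the n₀-fold iterate of L_s and D₂ := ⋃_{words a of length 2} D_a. -/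
open Complex MeasureTheory Metric Set
open scoped Real

noncomputable section


abbrev SL2R := Matrix.SpecialLinearGroup (Fin 2) ℝ

/-- Entries of a matrix in `SL(2,ℝ)`, as complex numbers. -/
def mA (g : SL2R) : ℂ := ((g.1 0 0 : ℝ) : ℂ)
def mB (g : SL2R) : ℂ := ((g.1 0 1 : ℝ) : ℂ)
def mC (g : SL2R) : ℂ := ((g.1 1 0 : ℝ) : ℂ)
def mD (g : SL2R) : ℂ := ((g.1 1 1 : ℝ) : ℂ)

/-- The Möbius action of `SL(2,ℝ)` on the Riemann sphere `ℂ ∪ {∞}`. -/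
def moebius (g : SL2R) : OnePoint ℂ → OnePoint ℂ := fun z =>
  match z with
  | OnePoint.infty => if mC g = 0 then OnePoint.infty else ((mA g / mC g : ℂ) : OnePoint ℂ)
  | (w : ℂ) => if mC g * w + mD g = 0 then OnePoint.infty
      else (((mA g * w + mB g) / (mC g * w + mD g) : ℂ) : OnePoint ℂ)

/-- The Möbius action on `ℂ`, with junk value at the pole. -/
def moebiusC (g : SL2R) (z : ℂ) : ℂ := (mA g * z + mB g) / (mC g * z + mD g)

/-- The Möbius action on `ℝ`, with junk value at the pole. -/
def moebiusR (g : SL2R) (x : ℝ) : ℝ :=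
  (g.1 0 0 * x + g.1 0 1) / (g.1 1 0 * x + g.1 1 1)

/-- The complex derivative `γ'(z) = (cz+d)⁻²` of a Möbius transformation (`det = 1`). -/
def dMob (g : SL2R) (z : ℂ) : ℂ := ((mC g * z + mD g)⁻¹) ^ 2

/-- The involution `a ↦ ā` on the alphabet `{1, …, 2r}` (as `Fin (2*r)`). -/
def bar {r : ℕ} (a : Fin (2 * r)) : Fin (2 * r) :=
  if h : (a : ℕ) < r then ⟨(a : ℕ) + r, by omega⟩
  else ⟨(a : ℕ) - r, by have := a.isLt; omega⟩

/-- Schottky data: `2r` pairwise disjoint closed disks centered on the real axis and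
`2r` elements of `SL(2,ℝ)` with `γ_a((ℂ∪{∞}) \ interior D_{ā}) = D_a`, `γ_ā = γ_a⁻¹`. -/
structure Schottky (r : ℕ) where
  hr : 1 ≤ r
  center : Fin (2 * r) → ℝ
  radius : Fin (2 * r) → ℝ
  radius_pos : ∀ a, 0 < radius a
  disj : Pairwise fun a b =>
    Disjoint (closedBall ((center a : ℝ) : ℂ) (radius a)) (closedBall ((center b : ℝ) : ℂ) (radius b))
  γ : Fin (2 * r) → SL2R
  γ_bar : ∀ a, γ (bar a) = (γ a)⁻¹
  γ_maps : ∀ a, moebius (γ a) ''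
      (univ \ ((fun z : ℂ => (z : OnePoint ℂ)) '' interior (closedBall ((center (bar a) : ℝ) : ℂ) (radius (bar a)))))
    = (fun z : ℂ => (z : OnePoint ℂ)) '' closedBall ((center a : ℝ) : ℂ) (radius a)

/-- Words: finite sequences of letters with `a_{j+1} ≠ ā_j`. -/
def IsWord {r : ℕ} (w : List (Fin (2 * r))) : Prop := w.Chain' fun x y => y ≠ bar x

/-- The word `ā := ā_n ⋯ ā_1`. -/
def barWord {r : ℕ} (w : List (Fin (2 * r))) : List (Fin (2 * r)) := (w.map bar).reverse

namespace Schottky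

variable {r : ℕ} (S : Schottky r)

/-- The disk `D_a` for a letter `a`. -/
def disk (a : Fin (2 * r)) : Set ℂ := closedBall ((S.center a : ℝ) : ℂ) (S.radius a)

/-- `γ_w := γ_{a_1} ⋯ γ_{a_n}`. -/
def g (w : List (Fin (2 * r))) : SL2R := (w.map S.γ).prod

/-- The disk `D_w := γ_{w'}(D_{a_n})` of a nonempty word, as a subset of the Riemann sphere. -/
def sdisk : List (Fin (2 * r)) → Set (OnePoint ℂ)
  | [] => ∅
  | a :: w => moebius (S.g ((a :: w).dropLast)) ''
      ((fun z : ℂ => (z : OnePoint ℂ)) '' S.disk ((a :: w).getLast (List.cons_ne_nil a w)))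

/-- The disk `D_w` as a subset of `ℂ`. -/
def wdisk (w : List (Fin (2 * r))) : Set ℂ := {z : ℂ | (z : OnePoint ℂ) ∈ S.sdisk w}

/-- The interval `I_w = D_w ∩ ℝ`, as a subset of `ℝ`. -/
def wint (w : List (Fin (2 * r))) : Set ℝ := {x : ℝ | ((x : ℝ) : ℂ) ∈ S.wdisk w}

/-- The length `|I_w|` of the interval `I_w`. -/
def wlen (w : List (Fin (2 * r))) : ℝ := Metric.diam (S.wint w)

/-- `D = ⋃_{a ∈ A} D_a`. -/
def D : Set ℂ := ⋃ a, S.disk a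

/-- `I = D ∩ ℝ`, as a subset of `ℝ`. -/
def Ire : Set ℝ := {x : ℝ | ((x : ℝ) : ℂ) ∈ S.D}

/-- `D₂ = ⋃_{|w| = 2} D_w`. -/
def D₂ : Set ℂ := ⋃ (a : Fin (2 * r)), ⋃ (b : Fin (2 * r)), ⋃ (_ : b ≠ bar a), S.wdisk [a, b]

/-- `I'_a` for a letter `a`: the convex hull of `⋃_{b ≠ ā} I_{ab}`. -/
def iprimeLetter (a : Fin (2 * r)) : Set ℝ :=
  convexHull ℝ (⋃ (b : Fin (2 * r)), ⋃ (_ : b ≠ bar a), S.wint [a, b])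

/-- `I'_w := γ_{w'}(I'_{a_n})` for a nonempty word `w`. -/
def iprime : List (Fin (2 * r)) → Set ℝ
  | [] => ∅
  | a :: w => moebiusR (S.g ((a :: w).dropLast)) ''
      S.iprimeLetter ((a :: w).getLast (List.cons_ne_nil a w))

/-- The partition `Z(τ)`. -/
def Ztau (τ : ℝ) : Set (List (Fin (2 * r))) :=
  {w | w ≠ [] ∧ IsWord w ∧ S.wlen w ≤ τ ∧ (w.dropLast = [] ∨ τ < S.wlen w.dropLast)}

/-- The limit set `Λ_Γ ⊂ ℝ`. -/
def limitSet : Set ℝ :=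
  {x : ℝ | ∀ n : ℕ, 1 ≤ n → ∃ w : List (Fin (2 * r)), IsWord w ∧ w.length = n ∧ x ∈ S.wint w}

/-- The τ-neighbourhood `Λ_Γ(τ) ⊂ ℝ` of the limit set. -/
def limitSetNbhd (τ : ℝ) : Set ℝ := {x : ℝ | ∃ y ∈ S.limitSet, |x - y| ≤ τ}

end Schottky

/-- `ℓ` is a holomorphic branch on `U` of the logarithm of the derivative of the Möbius
transformation of `g`, real on `U ∩ ℝ`. -/
structure IsLogBranch (g : SL2R) (U : Set ℂ) (ℓ : ℂ → ℂ) : Prop where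
  holo : DifferentiableOn ℂ ℓ U
  exp_eq : ∀ z ∈ U, Complex.exp (ℓ z) = dMob g z
  real_on : ∀ x : ℝ, ((x : ℝ) : ℂ) ∈ U → (ℓ ((x : ℝ) : ℂ)).im = 0

/-- A family of branches `ℓ a b` of `log γ_a'` on `D_b`, for all `a ≠ b̄`. -/
def IsBranchFamily {r : ℕ} (S : Schottky r) (ℓ : Fin (2 * r) → Fin (2 * r) → ℂ → ℂ) : Prop :=
  ∀ a b : Fin (2 * r), a ≠ bar b → IsLogBranch (S.γ a) (S.disk b) (ℓ a b)

/-- The fixed-point equation `L_s u = u` on the interior of `D`, written pointwise. -/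
def TransferFixed {r : ℕ} (S : Schottky r) (s : ℂ)
    (ℓ : Fin (2 * r) → Fin (2 * r) → ℂ → ℂ) (u : ℂ → ℂ) : Prop :=
  ∀ b : Fin (2 * r), ∀ z ∈ interior (S.disk b),
    u z = ∑ a : Fin (2 * r), if a ≠ bar b then
      Complex.exp (s * ℓ a b z) * u (moebiusC (S.γ a) z) else 0

/-- The transfer operator `L_s`, as an operator on functions. -/
def transferOp {r : ℕ} (S : Schottky r) (s : ℂ)
    (ℓ : Fin (2 * r) → Fin (2 * r) → ℂ → ℂ) (u : ℂ → ℂ) : ℂ → ℂ := fun z =>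
  ∑ b : Fin (2 * r), (S.disk b).indicator
    (fun w => ∑ a : Fin (2 * r), if a ≠ bar b then
      Complex.exp (s * ℓ a b w) * u (moebiusC (S.γ a) w) else 0) z

/-- A partition: a finite set of nonempty words such that every long enough word
has exactly one prefix in it. -/
def IsPartition {r : ℕ} (S : Schottky r) (Z : Finset (List (Fin (2 * r)))) : Prop :=
  (∀ w ∈ Z, w ≠ [] ∧ IsWord w) ∧
  ∃ N : ℕ, ∀ w : List (Fin (2 * r)), IsWord w → N ≤ w.length →
    ∃! p : List (Fin (2 * r)), p ∈ Z ∧ p <+: w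


theorem det_entries (g : SL2R) : g.1 0 0 * g.1 1 1 - g.1 0 1 * g.1 1 0 = 1 := by
  have h := g.2
  rwa [Matrix.det_fin_two] at h

theorem mA_mul_mD_sub (g : SL2R) : mA g * mD g - mB g * mC g = 1 := by
  have h := det_entries g
  simp only [mA, mB, mC, mD]
  exact_mod_cast h

theorem moebius_coe (g : SL2R) {w : ℂ} (hw : mC g * w + mD g ≠ 0) :
    moebius g (w : OnePoint ℂ) = ((moebiusC g w : ℂ) : OnePoint ℂ) :=
  if_neg hw

theorem moebius_coe_pole (g : SL2R) {w : ℂ} (hw : mC g * w + mD g = 0) :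
    moebius g (w : OnePoint ℂ) = OnePoint.infty :=
  if_pos hw

theorem eq_coe_of_moebius_eq_coe (g : SL2R) {p : OnePoint ℂ} {t : ℂ}
    (ht : mC g * t + mD g ≠ 0) (h : moebius g p = ((moebiusC g t : ℂ) : OnePoint ℂ)) :
    p = (t : OnePoint ℂ) := by
  have hdet := mA_mul_mD_sub g
  induction p using OnePoint.rec with
  | infty =>
    exfalso
    change (if mC g = 0 then OnePoint.infty else ((mA g / mC g : ℂ) : OnePoint ℂ)) = _ at h
    split_ifs at h with hc
    · exact OnePoint.coe_ne_infty _ h.symm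
    · have h' := OnePoint.coe_injective h
      rw [moebiusC, div_eq_div_iff hc ht] at h'
      apply one_ne_zero (α := ℂ)
      linear_combination h' - hdet
  | coe w =>
    by_cases hw : mC g * w + mD g = 0
    · rw [moebius_coe_pole g hw] at h
      exact absurd h.symm (OnePoint.coe_ne_infty _)
    · rw [moebius_coe g hw] at h
      have h' := OnePoint.coe_injective h
      rw [moebiusC, moebiusC, div_eq_div_iff hw ht] at h'
      congr 1
      linear_combination h' + (t - w) * hdet

theorem norm_dMob (g : SL2R) (z : ℂ) : ‖dMob g z‖ = (normSq (mC g * z + mD g))⁻¹ := by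
  rw [dMob, norm_pow, norm_inv, normSq_eq_norm_sq, inv_pow]

theorem moebiusC_im (g : SL2R) (z : ℂ) : (moebiusC g z).im = ‖dMob g z‖ * z.im := by
  have hdet := det_entries g
  rw [norm_dMob, moebiusC, Complex.div_im]
  simp only [mA, mB, mC, mD, add_re, add_im, mul_re, mul_im, ofReal_re, ofReal_im]
  linear_combination
    (normSq (((g.1 1 0 : ℝ) : ℂ) * z + ((g.1 1 1 : ℝ) : ℂ)))⁻¹ * z.im * hdet

theorem abs_moebiusC_im (g : SL2R) (z : ℂ) :
    |(moebiusC g z).im| = ‖dMob g z‖ * |z.im| := by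
  rw [moebiusC_im, abs_mul, abs_norm]

theorem bar_bar {r : ℕ} (a : Fin (2 * r)) : bar (bar a) = a := by
  have := a.isLt
  ext
  unfold bar
  by_cases h : (a : ℕ) < r
  · simp [h]
  · have h2 : (a : ℕ) - r < r := by omega
    simp only [h, dite_false, h2, dite_true]
    omega

namespace Schottky

variable {r : ℕ} (S : Schottky r)

theorem moebius_mem_disk {a : Fin (2 * r)} {z : ℂ}
    (hz : z ∉ interior (S.disk (bar a))) :
    mC (S.γ a) * z + mD (S.γ a) ≠ 0 ∧ moebiusC (S.γ a) z ∈ S.disk a := by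
  have hmem : moebius (S.γ a) (z : OnePoint ℂ) ∈
      (fun z : ℂ => (z : OnePoint ℂ)) '' closedBall ((S.center a : ℝ) : ℂ) (S.radius a) := by
    rw [← S.γ_maps a]
    refine mem_image_of_mem _ ⟨mem_univ _, ?_⟩
    rintro ⟨w, hw, hwz⟩
    exact hz (OnePoint.coe_injective hwz ▸ hw)
  obtain ⟨w, hw, hwz⟩ := hmem
  have hne : mC (S.γ a) * z + mD (S.γ a) ≠ 0 := by
    intro h0
    rw [moebius_coe_pole _ h0] at hwz
    exact OnePoint.coe_ne_infty _ hwz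
  refine ⟨hne, ?_⟩
  rw [moebius_coe _ hne] at hwz
  exact OnePoint.coe_injective hwz ▸ hw

theorem moebiusC_notMem_disk {a : Fin (2 * r)} {z : ℂ}
    (hz : z ∈ interior (S.disk (bar a))) (hne : mC (S.γ a) * z + mD (S.γ a) ≠ 0) :
    moebiusC (S.γ a) z ∉ S.disk a := by
  intro hmem
  have h : ((moebiusC (S.γ a) z : ℂ) : OnePoint ℂ) ∈
      (fun z : ℂ => (z : OnePoint ℂ)) '' closedBall ((S.center a : ℝ) : ℂ) (S.radius a) :=
    mem_image_of_mem _ hmem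
  rw [← S.γ_maps a] at h
  obtain ⟨p, ⟨-, hp⟩, hpz⟩ := h
  rw [eq_coe_of_moebius_eq_coe _ hne hpz] at hp
  exact hp (mem_image_of_mem _ hz)

/-- The reciprocal of the hyperbolic density of the disk `D_a`, up to a constant factor,
extended to the whole plane. -/
def weight (a : Fin (2 * r)) (z : ℂ) : ℝ :=
  S.radius a - normSq (z - S.center a) / S.radius a

theorem mem_disk_iff {a : Fin (2 * r)} {z : ℂ} :
    z ∈ S.disk a ↔ normSq (z - S.center a) ≤ S.radius a ^ 2 := by
  rw [disk, mem_closedBall, dist_eq_norm, normSq_eq_norm_sq,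
    sq_le_sq₀ (norm_nonneg _) (S.radius_pos a).le]

theorem mem_interior_disk_iff {a : Fin (2 * r)} {z : ℂ} :
    z ∈ interior (S.disk a) ↔ normSq (z - S.center a) < S.radius a ^ 2 := by
  rw [disk, interior_closedBall _ (S.radius_pos a).ne', mem_ball, dist_eq_norm,
    normSq_eq_norm_sq, sq_lt_sq₀ (norm_nonneg _) (S.radius_pos a).le]

theorem weight_nonneg {a : Fin (2 * r)} {z : ℂ} (hz : z ∈ S.disk a) : 0 ≤ S.weight a z := by
  have hR := S.radius_pos a
  rw [mem_disk_iff] at hz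
  rw [weight, sub_nonneg, div_le_iff₀ hR]
  nlinarith

theorem weight_le_radius (a : Fin (2 * r)) (z : ℂ) : S.weight a z ≤ S.radius a :=
  sub_le_self _ (div_nonneg (normSq_nonneg _) (S.radius_pos a).le)

/-- The coefficients of the pull-back of the circle `∂D_a` under `γ_a`: it is `∂D_ā`. -/
theorem circle_coefficients (a : Fin (2 * r)) :
    ∃ α : ℝ, α * S.radius (bar a) = S.radius a ∧
      S.radius a ^ 2 * (S.γ a).1 1 0 ^ 2 -
        ((S.γ a).1 0 0 - S.center a * (S.γ a).1 1 0) ^ 2 = α ∧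
      S.radius a ^ 2 * ((S.γ a).1 1 0 * (S.γ a).1 1 1) -
        ((S.γ a).1 0 0 - S.center a * (S.γ a).1 1 0) *
          ((S.γ a).1 0 1 - S.center a * (S.γ a).1 1 1) = -α * S.center (bar a) ∧
      S.radius a ^ 2 * (S.γ a).1 1 1 ^ 2 -
        ((S.γ a).1 0 1 - S.center a * (S.γ a).1 1 1) ^ 2 =
          α * (S.center (bar a) ^ 2 - S.radius (bar a) ^ 2) := by
  have hdet := det_entries (S.γ a)
  have hR := S.radius_pos a
  have hR' := S.radius_pos (bar a)
  have hout := fun t : ℝ => S.moebius_mem_disk (a := a) (z := (t : ℂ))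
  have hin := fun t : ℝ => S.moebiusC_notMem_disk (a := a) (z := (t : ℂ))
  simp only [mem_disk_iff, mem_interior_disk_iff, moebiusC, mA, mB, mC, mD, ← ofReal_mul,
    ← ofReal_add, ← ofReal_div, ← ofReal_sub, normSq_ofReal, ofReal_ne_zero] at hout hin
  generalize S.radius a = R at *
  generalize S.radius (bar a) = R' at *
  generalize S.center a = x at *
  generalize S.center (bar a) = x' at *
  generalize (S.γ a).1 0 0 = p at *
  generalize (S.γ a).1 0 1 = q at *
  generalize (S.γ a).1 1 0 = c at *
  generalize (S.γ a).1 1 1 = d at *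
  set F : ℝ → ℝ := fun t => R ^ 2 * (c * t + d) ^ 2 - (p * t + q - x * (c * t + d)) ^ 2 with hF
  have key : ∀ t : ℝ, c * t + d ≠ 0 →
      (((p * t + q) / (c * t + d) - x) * ((p * t + q) / (c * t + d) - x) ≤ R ^ 2 ↔ 0 ≤ F t) := by
    intro t ht
    have hpos : 0 < (c * t + d) ^ 2 := by positivity
    have e : ((p * t + q) / (c * t + d) - x) * ((p * t + q) / (c * t + d) - x) =
        (p * t + q - x * (c * t + d)) ^ 2 / (c * t + d) ^ 2 := by
      rw [← div_pow, sub_div, mul_div_cancel_right₀ _ ht, sq]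
    rw [e, div_le_iff₀ hpos, hF]
    simp only [sub_nonneg]
  have Fout : ∀ t : ℝ, R' ≤ |t - x'| → 0 ≤ F t := by
    intro t ht
    have h1 : ¬ (t - x') * (t - x') < R' ^ 2 := by
      rw [← abs_mul_abs_self]; nlinarith
    obtain ⟨h2, h3⟩ := hout t h1
    exact (key t h2).1 h3
  have Fint : ∀ t ∈ Ioo (x' - R') (x' + R'), F t ≤ 0 := by
    intro t ht
    have h1 : (t - x') * (t - x') < R' ^ 2 := by nlinarith [ht.1, ht.2]
    by_cases h0 : c * t + d = 0
    · simp only [hF, h0]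
      nlinarith [sq_nonneg (p * t + q - x * 0)]
    · have := hin t h1 h0
      rw [key t h0] at this
      exact (not_le.1 this).le
  have Fcl : ∀ t ∈ Icc (x' - R') (x' + R'), F t ≤ 0 := by
    have hcl : IsClosed {t : ℝ | F t ≤ 0} :=
      isClosed_le (by simp only [hF]; fun_prop) continuous_const
    rw [← closure_Ioo (by linarith)]
    exact closure_minimal Fint hcl
  have F1 : F (x' - R') = 0 := le_antisymm (Fcl _ ⟨le_rfl, by linarith⟩)
    (Fout _ (by rw [show x' - R' - x' = -R' by ring, abs_neg]; exact le_abs_self _))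
  have F2 : F (x' + R') = 0 := le_antisymm (Fcl _ ⟨by linarith, le_rfl⟩)
    (Fout _ (by rw [show x' + R' - x' = R' by ring]; exact le_abs_self _))
  have F3 : 0 ≤ F (x' + 2 * R') := Fout _ (by
    rw [show x' + 2 * R' - x' = 2 * R' by ring]; exact le_trans (by linarith) (le_abs_self _))
  simp only [hF] at F1 F2 F3
  set α := R ^ 2 * c ^ 2 - (p - x * c) ^ 2 with hα
  set β := R ^ 2 * (c * d) - (p - x * c) * (q - x * d) with hβ
  set κ := R ^ 2 * d ^ 2 - (q - x * d) ^ 2 with hκ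
  have G1 : α * (x' - R') ^ 2 + 2 * β * (x' - R') + κ = 0 := by
    rw [← F1, hα, hβ, hκ]; ring
  have G2 : α * (x' + R') ^ 2 + 2 * β * (x' + R') + κ = 0 := by
    rw [← F2, hα, hβ, hκ]; ring
  have G3 : 0 ≤ α * (x' + 2 * R') ^ 2 + 2 * β * (x' + 2 * R') + κ := by
    refine F3.trans_eq ?_
    rw [hα, hβ, hκ]; ring
  have hβ' : β = -α * x' := by
    have : 4 * R' * (β + α * x') = 0 := by linear_combination G2 - G1
    have := (mul_eq_zero.1 this).resolve_left (by positivity)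
    linear_combination this
  have hκ' : κ = α * (x' ^ 2 - R' ^ 2) := by
    rw [hβ'] at G1
    linear_combination G1
  have hαnn : 0 ≤ α := by
    rw [hβ', hκ'] at G3
    have : 0 ≤ α * (3 * R' ^ 2) := by linarith
    exact nonneg_of_mul_nonneg_left this (by positivity)
  have hdisc : β ^ 2 - α * κ = R ^ 2 := by
    rw [hα, hβ, hκ]
    linear_combination R ^ 2 * (p * d - q * c + 1) * hdet
  refine ⟨α, ?_, rfl, hβ', hκ'⟩
  rw [hβ', hκ'] at hdisc
  have : (α * R') ^ 2 = R ^ 2 := by linear_combination hdisc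
  exact (sq_eq_sq₀ (by positivity) hR.le).1 this

theorem weight_moebiusC {a : Fin (2 * r)} {z : ℂ} (hne : mC (S.γ a) * z + mD (S.γ a) ≠ 0) :
    S.weight a (moebiusC (S.γ a) z) = ‖dMob (S.γ a) z‖ * -S.weight (bar a) z := by
  obtain ⟨α, h0, h1, h2, h3⟩ := S.circle_coefficients a
  have hR := S.radius_pos a
  have hR' := S.radius_pos (bar a)
  have hN : normSq (mC (S.γ a) * z + mD (S.γ a)) ≠ 0 := by simpa using hne
  have e1 : moebiusC (S.γ a) z - S.center a =
      (mA (S.γ a) * z + mB (S.γ a) - S.center a * (mC (S.γ a) * z + mD (S.γ a))) /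
        (mC (S.γ a) * z + mD (S.γ a)) := by
    rw [moebiusC, sub_div, mul_div_cancel_right₀ _ hne]
  have e2 : S.radius a ^ 2 * normSq (mC (S.γ a) * z + mD (S.γ a)) -
      normSq (mA (S.γ a) * z + mB (S.γ a) - S.center a * (mC (S.γ a) * z + mD (S.γ a))) =
      α * (normSq (z - S.center (bar a)) - S.radius (bar a) ^ 2) := by
    simp only [mA, mB, mC, mD, normSq_apply, add_re, add_im, sub_re, sub_im, mul_re, mul_im,
      ofReal_re, ofReal_im]
    linear_combination (z.re ^ 2 + z.im ^ 2) * h1 + 2 * z.re * h2 + h3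
  rw [weight, weight, e1, normSq_div, norm_dMob]
  have h4 : α = S.radius a / S.radius (bar a) := by rw [← h0]; field_simp
  rw [h4] at e2
  field_simp at e2 ⊢
  linear_combination e2

theorem radius_add_lt {a b : Fin (2 * r)} (hab : a ≠ b) :
    S.radius a + S.radius b < |S.center a - S.center b| := by
  have h : Disjoint (closedBall ((S.center a : ℝ) : ℂ) (S.radius a))
      (closedBall ((S.center b : ℝ) : ℂ) (S.radius b)) := S.disj hab
  rw [disjoint_closedBall_closedBall_iff (S.radius_pos a).le (S.radius_pos b).le, dist_eq_norm,
    ← ofReal_sub, norm_real] at h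
  exact h

/-- Hyperbolic densities of a disk and of the exterior of a disjoint disk are separated by
a uniform factor. -/
theorem exists_contraction : ∃ θ : ℝ, 0 < θ ∧ θ < 1 ∧ ∀ a b : Fin (2 * r), a ≠ b →
    ∀ z, S.weight b z ≤ θ * -S.weight a z := by
  have h : ∀ᶠ θ : ℝ in nhdsWithin 1 (Iio 1), ∀ a b : Fin (2 * r), a ≠ b →
      (θ * S.radius a + S.radius b) * (θ * S.radius b + S.radius a) <
        θ * (S.center a - S.center b) ^ 2 := by
    simp only [Filter.eventually_all]
    intro a b hab
    have hlt := S.radius_add_lt hab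
    have h1 : (1 * S.radius a + S.radius b) * (1 * S.radius b + S.radius a) <
        1 * (S.center a - S.center b) ^ 2 := by
      rw [← sq_abs (S.center a - S.center b)]
      nlinarith [S.radius_pos a, S.radius_pos b]
    have hc1 : Continuous fun θ : ℝ =>
      (θ * S.radius a + S.radius b) * (θ * S.radius b + S.radius a) := by fun_prop
    have hc2 : Continuous fun θ : ℝ => θ * (S.center a - S.center b) ^ 2 := by fun_prop
    exact nhdsWithin_le_nhds ((hc1.tendsto 1).eventually_lt (hc2.tendsto 1) h1)
  have h0 : ∀ᶠ θ : ℝ in nhdsWithin 1 (Iio 1), 0 < θ :=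
    nhdsWithin_le_nhds (lt_mem_nhds one_pos)
  obtain ⟨θ, ⟨hθ, hpos⟩, hlt⟩ := ((h.and h0).and self_mem_nhdsWithin).exists
  refine ⟨θ, hpos, hlt, fun a b hab z => ?_⟩
  have hab := hθ a b hab
  have hRa := S.radius_pos a
  have hRb := S.radius_pos b
  rw [weight, weight]
  simp only [normSq_apply, sub_re, sub_im, ofReal_re, ofReal_im]
  generalize S.radius a = A at *
  generalize S.radius b = B at *
  generalize S.center a = x at *
  generalize S.center b = y at *
  generalize z.re = u at *
  generalize z.im = v at *
  have e : 0 ≤ (θ * -(A - ((u - x) * (u - x) + (v - 0) * (v - 0)) / A) -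
      (B - ((u - y) * (u - y) + (v - 0) * (v - 0)) / B)) * (A * B * (θ * B + A)) := by
    have : (θ * -(A - ((u - x) * (u - x) + (v - 0) * (v - 0)) / A) -
      (B - ((u - y) * (u - y) + (v - 0) * (v - 0)) / B)) * (A * B * (θ * B + A)) =
      ((θ * B + A) * (u - y) - θ * B * (x - y)) ^ 2 + (θ * B + A) ^ 2 * v ^ 2
      + A * B * (θ * (x - y) ^ 2 - (θ * A + B) * (θ * B + A)) := by
      field_simp
      ring
    rw [this]
    have := mul_nonneg (mul_pos hRa hRb).le (sub_nonneg.2 hab.le)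
    positivity
  exact sub_nonneg.1 (nonneg_of_mul_nonneg_left e (by positivity))

theorem exists_separation : ∃ m : ℝ, 0 < m ∧ ∀ a b : Fin (2 * r), a ≠ b →
    ∀ z ∈ S.disk b, m ≤ -S.weight a z := by
  have h : ∀ᶠ m : ℝ in nhdsWithin 0 (Ioi 0), ∀ a b : Fin (2 * r), a ≠ b →
      m * S.radius a + S.radius a ^ 2 < (|S.center a - S.center b| - S.radius b) ^ 2 := by
    simp only [Filter.eventually_all]
    intro a b hab
    have hlt := S.radius_add_lt hab
    have h1 : 0 * S.radius a + S.radius a ^ 2 <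
        (|S.center a - S.center b| - S.radius b) ^ 2 := by
      nlinarith [S.radius_pos a, S.radius_pos b]
    have hc : Continuous fun m : ℝ => m * S.radius a + S.radius a ^ 2 := by fun_prop
    exact nhdsWithin_le_nhds ((hc.tendsto 0).eventually_lt tendsto_const_nhds h1)
  obtain ⟨m, hm, hpos⟩ := (h.and self_mem_nhdsWithin).exists
  refine ⟨m, hpos, fun a b hab z hz => ?_⟩
  have hm := hm a b hab
  have hlt := S.radius_add_lt hab
  have hRa := S.radius_pos a
  have hRb := S.radius_pos b
  have hz' : ‖z - S.center b‖ ≤ S.radius b := by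
    rwa [disk, mem_closedBall, dist_eq_norm] at hz
  have ht : |S.center a - S.center b| ≤ ‖z - S.center a‖ + ‖z - S.center b‖ := by
    rw [← Real.norm_eq_abs, ← norm_real, ofReal_sub,
      show (S.center a : ℂ) - S.center b = (z - S.center b) - (z - S.center a) by ring, add_comm]
    exact norm_sub_le _ _
  rw [weight, neg_sub, le_sub_iff_add_le, le_div_iff₀ hRa, normSq_eq_norm_sq]
  nlinarith

end Schottky

theorem IsLogBranch.hasDerivWithinAt {g : SL2R} {U : Set ℂ} {ℓ : ℂ → ℂ} (h : IsLogBranch g U ℓ)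
    {z : ℂ} (hz : z ∈ U) (hU : UniqueDiffWithinAt ℂ U z) (hne : mC g * z + mD g ≠ 0) :
    HasDerivWithinAt ℓ (-2 * mC g * (mC g * z + mD g)⁻¹) U z := by
  have h1 := (h.holo z hz).hasDerivWithinAt
  have h2 : HasDerivWithinAt (fun w => Complex.exp (ℓ w)) _ U z := h1.cexp
  have h3 : HasDerivAt (fun w => mC g * w + mD g) (mC g) z := by
    simpa using ((hasDerivAt_id z).const_mul (mC g)).add_const (mD g)
  have h4 : HasDerivWithinAt (dMob g) _ U z := ((h3.inv hne).pow 2).hasDerivWithinAt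
  have h5 := hU.eq_deriv _ h2 (h4.congr h.exp_eq (h.exp_eq z hz))
  rw [h.exp_eq z hz, dMob] at h5
  have h6 : ((mC g * z + mD g)⁻¹) ^ 2 ≠ 0 := pow_ne_zero _ (inv_ne_zero hne)
  have h7 : -2 * mC g * (mC g * z + mD g)⁻¹ = derivWithin ℓ U z := by
    apply mul_left_cancel₀ h6
    rw [h5]
    simp only [Pi.inv_apply, Nat.cast_ofNat, Nat.add_one_sub_one, pow_one]
    field_simp
  rw [h7]
  exact h1

theorem norm_inv_denominator_le {g : SL2R} {z : ℂ} {Λ : ℝ} (hΛ : 1 ≤ Λ) (h : ‖dMob g z‖ ≤ Λ) :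
    ‖(mC g * z + mD g)⁻¹‖ ≤ Λ := by
  rw [dMob, norm_pow] at h
  nlinarith [norm_nonneg ((mC g * z + mD g)⁻¹)]

theorem IsLogBranch.abs_im_le {g : SL2R} {x R Λ : ℝ} {ℓ : ℂ → ℂ}
    (h : IsLogBranch g (closedBall (x : ℂ) R) ℓ) (hR : 0 < R)
    (hne : ∀ z ∈ closedBall (x : ℂ) R, mC g * z + mD g ≠ 0) (hΛ : 1 ≤ Λ)
    (hd : ∀ z ∈ closedBall (x : ℂ) R, ‖dMob g z‖ ≤ Λ) {z : ℂ} (hz : z ∈ closedBall (x : ℂ) R) :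
    |(ℓ z).im| ≤ 2 * |g.1 1 0| * Λ * |z.im| := by
  have hU : UniqueDiffOn ℂ (closedBall (x : ℂ) R) := by
    refine uniqueDiffOn_convex_of_isRCLikeNormedField (convex_closedBall _ _) ?_
    rw [interior_closedBall _ hR.ne']
    exact nonempty_ball.2 hR
  have hre : ((z.re : ℝ) : ℂ) ∈ closedBall (x : ℂ) R := by
    rw [mem_closedBall, dist_eq_norm] at hz ⊢
    rw [← ofReal_sub, norm_real]
    refine le_trans ?_ hz
    simpa using abs_re_le_norm (z - x)
  have hb : ∀ w ∈ closedBall (x : ℂ) R,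
      ‖-2 * mC g * (mC g * w + mD g)⁻¹‖ ≤ 2 * |g.1 1 0| * Λ := by
    intro w hw
    rw [norm_mul, norm_mul, norm_neg, Complex.norm_ofNat, mC, norm_real, Real.norm_eq_abs]
    exact mul_le_mul_of_nonneg_left (norm_inv_denominator_le hΛ (hd w hw)) (by positivity)
  have hmv := Convex.norm_image_sub_le_of_norm_hasDerivWithin_le
    (fun w hw => h.hasDerivWithinAt hw (hU w hw) (hne w hw)) hb (convex_closedBall _ _) hre hz
  have e1 : (ℓ z - ℓ (z.re : ℝ)).im = (ℓ z).im := by rw [sub_im, h.real_on _ hre, sub_zero]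
  have e2 : ‖z - (z.re : ℝ)‖ = |z.im| := by
    rw [show z - ((z.re : ℝ) : ℂ) = (z.im : ℝ) * I from
      sub_eq_of_eq_add' (re_add_im z).symm, norm_mul, norm_I, mul_one, norm_real,
      Real.norm_eq_abs]
  rw [← e1, ← e2]
  exact (abs_im_le_norm _).trans hmv

theorem norm_exp_mul_le {ℓ : ℂ} {Λ E h ν : ℝ} (hΛ : 1 ≤ Λ) (hh : 0 < h)
    (hν : ν ∈ Icc (0 : ℝ) (1 / 2)) (hre : ‖Complex.exp ℓ‖ ≤ Λ) (him : |ℓ.im| ≤ E) :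
    ‖Complex.exp ((1 / 2 - ν + I / h) * ℓ)‖ ≤ Λ * Real.exp (E / h) := by
  have e : ((1 / 2 - ν + I / h) * ℓ : ℂ).re = (1 / 2 - ν) * ℓ.re - ℓ.im / h := by
    have : (1 / 2 - ν + I / h : ℂ) = ((1 / 2 - ν : ℝ) : ℂ) + ((1 / h : ℝ) : ℂ) * I := by
      push_cast; ring
    rw [this]
    simp only [add_mul, add_re, mul_re, mul_im, ofReal_re, ofReal_im, I_re, I_im]
    ring
  rw [norm_exp] at hre ⊢
  rw [e]
  have h1 : ℓ.re ≤ Real.log Λ := (Real.le_log_iff_exp_le (by linarith)).2 hre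
  have h2 : 0 ≤ Real.log Λ := Real.log_nonneg hΛ
  have h3 : (1 / 2 - ν) * ℓ.re ≤ Real.log Λ := by
    nlinarith [mul_nonneg (sub_nonneg.2 hν.2) (sub_nonneg.2 h1), hν.1, hν.2]
  have h4 : -(ℓ.im / h) ≤ E / h := by
    rw [← neg_div]
    exact div_le_div_of_nonneg_right ((neg_le_abs _).trans him) hh.le
  calc Real.exp ((1 / 2 - ν) * ℓ.re - ℓ.im / h) ≤ Real.exp (Real.log Λ + E / h) :=
        Real.exp_le_exp.2 (by linarith)
    _ = Λ * Real.exp (E / h) := by rw [Real.exp_add, Real.exp_log (by linarith)]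

namespace Schottky

variable {r : ℕ} (S : Schottky r)

theorem bar_ne {a b : Fin (2 * r)} (hab : a ≠ bar b) : bar a ≠ b :=
  fun h => hab (by rw [← h, bar_bar])

theorem notMem_interior_disk {a b : Fin (2 * r)} (hab : a ≠ b) {z : ℂ} (hz : z ∈ S.disk b) :
    z ∉ interior (S.disk a) := fun h =>
  (disjoint_left.1 (S.disj hab)) (interior_subset h) hz

theorem moebiusC_mem_disk {a b : Fin (2 * r)} (hab : a ≠ bar b) {z : ℂ} (hz : z ∈ S.disk b) :
    mC (S.γ a) * z + mD (S.γ a) ≠ 0 ∧ moebiusC (S.γ a) z ∈ S.disk a :=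
  S.moebius_mem_disk (S.notMem_interior_disk (bar_ne hab) hz)

theorem moebiusC_mem_D₂ {a b : Fin (2 * r)} (hab : a ≠ bar b) {z : ℂ} (hz : z ∈ S.disk b) :
    moebiusC (S.γ a) z ∈ S.D₂ := by
  refine mem_iUnion.2 ⟨a, mem_iUnion.2 ⟨b, mem_iUnion.2 ⟨(bar_ne hab).symm, ?_⟩⟩⟩
  refine ⟨z, mem_image_of_mem _ hz, ?_⟩
  have hg : S.g [a, b].dropLast = S.γ a := by simp [g]
  rw [hg]
  exact moebius_coe _ (S.moebiusC_mem_disk hab hz).1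

theorem D₂_subset_D : S.D₂ ⊆ S.D := by
  intro w hw
  simp only [D₂, mem_iUnion] at hw
  obtain ⟨a, b, hab, p, ⟨z, hz, rfl⟩, hp⟩ := hw
  have hab' : a ≠ bar b := fun h => hab (by rw [h, bar_bar])
  have hz : z ∈ S.disk b := hz
  have hg : S.g [a, b].dropLast = S.γ a := by simp [g]
  obtain ⟨h1, h2⟩ := S.moebiusC_mem_disk hab' hz
  rw [hg, moebius_coe _ h1] at hp
  rw [← OnePoint.coe_injective hp]
  exact mem_iUnion.2 ⟨a, h2⟩

theorem isCompact_D : IsCompact S.D :=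
  isCompact_iUnion fun _ => isCompact_closedBall _ _

/-- Uniform bounds for the coefficients `γ_a'(z)^s` of the transfer operator. -/
theorem exists_branch_bound : ∃ Λ C₁ : ℝ, 0 < Λ ∧ 0 ≤ C₁ ∧ ∀ h ∈ Ioc (0 : ℝ) 1,
    ∀ ν ∈ Icc (0 : ℝ) (1 / 2), ∀ ℓ : Fin (2 * r) → Fin (2 * r) → ℂ → ℂ, IsBranchFamily S ℓ →
    ∀ a b : Fin (2 * r), a ≠ bar b → ∀ z ∈ S.disk b,
      ‖Complex.exp ((1 / 2 - ν + I / h) * ℓ a b z)‖ ≤ Λ * Real.exp (C₁ * |z.im| / h) := by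
  obtain ⟨m, hm, hsep⟩ := S.exists_separation
  have hQ : ∀ a, S.radius a ≤ ∑ b, S.radius b := fun a =>
    Finset.single_le_sum (fun b _ => (S.radius_pos b).le) (Finset.mem_univ a)
  have hc : ∀ a, |(S.γ a).1 1 0| ≤ ∑ b, |(S.γ b).1 1 0| := fun a =>
    Finset.single_le_sum (f := fun b => |(S.γ b).1 1 0|)
      (fun b _ => abs_nonneg _) (Finset.mem_univ a)
  set Q := ∑ b, S.radius b
  set c := ∑ b, |(S.γ b).1 1 0|
  set Λ := max 1 (Q / m)
  have hΛ : 1 ≤ Λ := le_max_left _ _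
  have hc0 : 0 ≤ c := Finset.sum_nonneg fun _ _ => abs_nonneg _
  refine ⟨Λ, 2 * c * Λ, by linarith, by positivity, ?_⟩
  intro h hh ν hν ℓ hℓ a b hab z hz
  have hd : ∀ w ∈ S.disk b, ‖dMob (S.γ a) w‖ ≤ Λ := by
    intro w hw
    have h1 := S.weight_moebiusC (S.moebiusC_mem_disk hab hw).1
    have h2 := S.weight_le_radius a (moebiusC (S.γ a) w)
    have h3 := hsep (bar a) b (bar_ne hab) w hw
    refine le_trans ?_ (le_max_right _ _)
    rw [le_div_iff₀ hm]
    calc ‖dMob (S.γ a) w‖ * m ≤ ‖dMob (S.γ a) w‖ * -S.weight (bar a) w := by gcongr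
      _ ≤ Q := by rw [← h1]; exact h2.trans (hQ a)
  refine norm_exp_mul_le hΛ hh.1 hν ?_ ?_
  · rw [(hℓ a b hab).exp_eq z hz]
    exact hd z hz
  · refine ((hℓ a b hab).abs_im_le (S.radius_pos b)
      (fun w hw => (S.moebiusC_mem_disk hab hw).1) hΛ hd hz).trans ?_
    gcongr
    exact hc a

theorem norm_transferOp_le {s : ℂ} {ℓ : Fin (2 * r) → Fin (2 * r) → ℂ → ℂ} {u : ℂ → ℂ}
    {b : Fin (2 * r)} {z : ℂ} (hz : z ∈ S.disk b) {A B : ℝ} (hA : 0 ≤ A) (hB : 0 ≤ B)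
    (h : ∀ a, a ≠ bar b → ‖Complex.exp (s * ℓ a b z)‖ ≤ A ∧ ‖u (moebiusC (S.γ a) z)‖ ≤ B) :
    ‖transferOp S s ℓ u z‖ ≤ (2 * r : ℕ) * (A * B) := by
  have e : transferOp S s ℓ u z = ∑ a : Fin (2 * r), if a ≠ bar b then
      Complex.exp (s * ℓ a b z) * u (moebiusC (S.γ a) z) else 0 := by
    rw [transferOp, Finset.sum_eq_single b, indicator_of_mem hz]
    · intro c _ hcb
      exact indicator_of_notMem (fun hc => disjoint_left.1 (S.disj hcb) hc hz) _
    · simp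
  rw [e]
  refine (norm_sum_le _ _).trans ?_
  refine (Finset.sum_le_card_nsmul _ _ (A * B) fun a _ => ?_).trans ?_
  · split_ifs with hab
    · rw [norm_mul]
      exact mul_le_mul (h a hab).1 (h a hab).2 (norm_nonneg _) hA
    · rw [norm_zero]
      positivity
  · simp

/-- Exponential growth of the iterates of the transfer operator at a point `z`, with a rate
governed by a bound `H` for the quotient of `|Im z|` by the weight of `z`. -/
theorem norm_iterate_transferOp_le {s : ℂ} {ℓ : Fin (2 * r) → Fin (2 * r) → ℂ → ℂ} {f : ℂ → ℂ}
    {Λ C₁ θ Q K M h : ℝ} (hh : 0 < h) (hΛ : 0 < Λ) (hC₁ : 0 ≤ C₁) (hK : 0 ≤ K) (hM : 0 ≤ M)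
    (hθ : 0 < θ) (hθ1 : θ < 1)
    (hcon : ∀ a b : Fin (2 * r), a ≠ b → ∀ z, S.weight b z ≤ θ * -S.weight a z)
    (hQ : ∀ a, S.radius a ≤ Q)
    (hexp : ∀ a b : Fin (2 * r), a ≠ bar b → ∀ z ∈ S.disk b,
      ‖Complex.exp (s * ℓ a b z)‖ ≤ Λ * Real.exp (C₁ * |z.im| / h))
    (hf : ∀ w ∈ S.D₂, ‖f w‖ ≤ M * Real.exp (K * |w.im| / h)) (n : ℕ) :
    ∀ b : Fin (2 * r), ∀ z ∈ S.disk b, z ∈ S.D₂ → ∀ H : ℝ, 0 ≤ H → |z.im| ≤ H * S.weight b z →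
      ‖(transferOp S s ℓ)^[n] f z‖ ≤
        ((2 * r : ℕ) * Λ) ^ n * M * Real.exp ((C₁ * Q * n + K * Q * θ ^ n) * H / h) := by
  have him : ∀ (b : Fin (2 * r)) (z : ℂ) (H : ℝ), 0 ≤ H → |z.im| ≤ H * S.weight b z →
      |z.im| ≤ Q * H := fun b z H hH hz =>
    hz.trans ((mul_le_mul_of_nonneg_left ((S.weight_le_radius b z).trans (hQ b)) hH).trans_eq
      (mul_comm _ _))
  induction n with
  | zero =>
    intro b z _ hz2 H hH hzH
    have := him b z H hH hzH
    refine (hf z hz2).trans ?_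
    rw [pow_zero, one_mul, Nat.cast_zero, mul_zero, zero_add, pow_zero, mul_one, mul_assoc K]
    gcongr
  | succ n ih =>
    intro b z hz hz2 H hH hzH
    have hQ0 : 0 ≤ Q := (S.radius_pos b).le.trans (hQ b)
    rw [Function.iterate_succ_apply']
    set E := (C₁ * Q * n + K * Q * θ ^ n) * (θ * H) / h with hE
    refine (S.norm_transferOp_le hz (A := Λ * Real.exp (C₁ * |z.im| / h))
      (B := ((2 * r : ℕ) * Λ) ^ n * M * Real.exp E) (by positivity) (by positivity)
      fun a hab => ⟨hexp a b hab z hz, ?_⟩).trans ?_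
    · obtain ⟨h1, h2⟩ := S.moebiusC_mem_disk hab hz
      refine ih a _ h2 (S.moebiusC_mem_D₂ hab hz) _ (by positivity) ?_
      rw [abs_moebiusC_im, S.weight_moebiusC h1]
      have := hcon (bar a) b (bar_ne hab) z
      calc ‖dMob (S.γ a) z‖ * |z.im|
          ≤ ‖dMob (S.γ a) z‖ * (H * (θ * -S.weight (bar a) z)) := by
            gcongr
            exact hzH.trans (by gcongr)
        _ = θ * H * (‖dMob (S.γ a) z‖ * -S.weight (bar a) z) := by ring
    · have h3 : C₁ * |z.im| / h + E ≤
          (C₁ * Q * (n + 1 : ℕ) + K * Q * θ ^ (n + 1)) * H / h := by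
        rw [hE, ← add_div]
        refine div_le_div_of_nonneg_right ?_ hh.le
        have h4 := mul_le_mul_of_nonneg_left (him b z H hH hzH) hC₁
        have h5 : 0 ≤ C₁ * Q * n * H * (1 - θ) :=
          mul_nonneg (by positivity) (by linarith)
        push_cast
        rw [pow_succ]
        linarith
      calc ((2 * r : ℕ) : ℝ) * (Λ * Real.exp (C₁ * |z.im| / h) *
            (((2 * r : ℕ) * Λ) ^ n * M * Real.exp E))
          = ((2 * r : ℕ) * Λ) ^ (n + 1) * M * Real.exp (C₁ * |z.im| / h + E) := by
            rw [Real.exp_add]; ring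
        _ ≤ _ := by gcongr

end Schottky

/-- There are `K ≥ 10`, `n₀ ≥ 1` and `C > 0` depending only on the Schottky
data such that for `s = 1/2 − ν + i/h` and any `f` continuous on `D`, holomorphic on its
interior, `sup_D e^{−K|Im z|/h}|L_s^{n₀} f| ≤ C sup_{D₂} e^{−K|Im z|/h}|f|`. -/
theorem stmt11 {r : ℕ} (S : Schottky r) :
    ∃ (K C : ℝ) (n₀ : ℕ), 10 ≤ K ∧ 1 ≤ n₀ ∧ 0 < C ∧
      ∀ h ∈ Set.Ioc (0 : ℝ) 1, ∀ ν ∈ Set.Icc (0 : ℝ) (1 / 2),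
      ∀ ℓ : Fin (2 * r) → Fin (2 * r) → ℂ → ℂ, IsBranchFamily S ℓ →
      ∀ f : ℂ → ℂ, ContinuousOn f S.D → DifferentiableOn ℂ f (interior S.D) →
      ∀ z ∈ S.D,
        Real.exp (-K * |z.im| / h) * ‖(transferOp S (1 / 2 - ν + I / h) ℓ)^[n₀] f z‖
          ≤ C * sSup ((fun w => Real.exp (-K * |w.im| / h) * ‖f w‖) '' S.D₂) := by
  obtain ⟨θ, hθ, hθ1, hcon⟩ := S.exists_contraction
  obtain ⟨m, hm, hsep⟩ := S.exists_separation
  obtain ⟨Λ, C₁, hΛ, hC₁, hexp⟩ := S.exists_branch_bound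
  have hQ : ∀ a, S.radius a ≤ ∑ b, S.radius b := fun a =>
    Finset.single_le_sum (fun b _ => (S.radius_pos b).le) (Finset.mem_univ a)
  set Q := ∑ b, S.radius b
  have hr : 0 < 2 * r := by have := S.hr; omega
  have hQ0 : 0 < Q := (S.radius_pos ⟨0, hr⟩).trans_le (hQ _)
  obtain ⟨n, hn⟩ := exists_pow_lt_of_lt_one (show 0 < m / (2 * Q) by positivity) hθ1
  set K := max 10 (2 * (C₁ + C₁ * Q * n / m)) with hKdef
  have hK10 : 10 ≤ K := le_max_left _ _
  have hK2 : 2 * (C₁ + C₁ * Q * n / m) ≤ K := le_max_right _ _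
  have hrpos : (0 : ℝ) < (2 * r : ℕ) := by exact_mod_cast hr
  refine ⟨K, ((2 * r : ℕ) * Λ) ^ (n + 1), n + 1, hK10, by omega, by positivity, ?_⟩
  intro h hh ν hν ℓ hℓ f hf _ z hz
  have hh0 : 0 < h := hh.1
  set M := sSup ((fun w => Real.exp (-K * |w.im| / h) * ‖f w‖) '' S.D₂)
  have hM : 0 ≤ M := Real.sSup_nonneg (by rintro _ ⟨w, -, rfl⟩; positivity)
  have hbdd : BddAbove ((fun w => Real.exp (-K * |w.im| / h) * ‖f w‖) '' S.D₂) := by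
    refine BddAbove.mono (image_mono S.D₂_subset_D) (S.isCompact_D.bddAbove_image ?_)
    exact ContinuousOn.mul (by fun_prop) hf.norm
  have hfM : ∀ w ∈ S.D₂, ‖f w‖ ≤ M * Real.exp (K * |w.im| / h) := by
    intro w hw
    have h1 : Real.exp (-K * |w.im| / h) * ‖f w‖ ≤ M := le_csSup hbdd (mem_image_of_mem _ hw)
    rw [neg_mul, neg_div, Real.exp_neg, inv_mul_le_iff₀ (Real.exp_pos _)] at h1
    linarith
  obtain ⟨b, hzb⟩ := mem_iUnion.1 hz
  set H := |z.im| / m with hH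
  set E := (C₁ * Q * n + K * Q * θ ^ n) * H / h with hE
  have hmain : ‖(transferOp S (1 / 2 - ν + I / h) ℓ)^[n + 1] f z‖ ≤
      (2 * r : ℕ) * (Λ * Real.exp (C₁ * |z.im| / h) *
        (((2 * r : ℕ) * Λ) ^ n * M * Real.exp E)) := by
    rw [Function.iterate_succ_apply']
    refine S.norm_transferOp_le hzb (by positivity) (by positivity)
      fun a hab => ⟨hexp h hh ν hν ℓ hℓ a b hab z hzb, ?_⟩
    obtain ⟨h1, h2⟩ := S.moebiusC_mem_disk hab hzb
    refine S.norm_iterate_transferOp_le hh0 hΛ hC₁ (by linarith) hM hθ hθ1 hcon hQ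
      (hexp h hh ν hν ℓ hℓ) hfM n a _ h2 (S.moebiusC_mem_D₂ hab hzb) H (by positivity) ?_
    rw [abs_moebiusC_im, S.weight_moebiusC h1]
    have := hsep (bar a) b (Schottky.bar_ne hab) z hzb
    calc ‖dMob (S.γ a) z‖ * |z.im| = H * (‖dMob (S.γ a) z‖ * m) := by
          rw [hH]; field_simp
      _ ≤ H * (‖dMob (S.γ a) z‖ * -S.weight (bar a) z) := by gcongr
  have hexponent : -K * |z.im| / h + (C₁ * |z.im| / h + E) ≤ 0 := by
    have h1 : Q * θ ^ n / m ≤ 1 / 2 := by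
      rw [lt_div_iff₀ (by positivity)] at hn
      rw [div_le_iff₀ hm]
      linarith
    have h2 : K * (Q * θ ^ n / m) ≤ K * (1 / 2) := by gcongr
    have e : -K * |z.im| / h + (C₁ * |z.im| / h + E) =
        -(K - (C₁ + C₁ * Q * n / m) - K * (Q * θ ^ n / m)) * (|z.im| / h) := by
      rw [hE, hH]; field_simp; ring
    rw [e, neg_mul, neg_nonpos]
    exact mul_nonneg (by linarith) (by positivity)
  calc Real.exp (-K * |z.im| / h) * ‖(transferOp S (1 / 2 - ν + I / h) ℓ)^[n + 1] f z‖
      ≤ Real.exp (-K * |z.im| / h) * ((2 * r : ℕ) * (Λ * Real.exp (C₁ * |z.im| / h) *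
        (((2 * r : ℕ) * Λ) ^ n * M * Real.exp E))) := by gcongr
    _ = ((2 * r : ℕ) * Λ) ^ (n + 1) * M *
        Real.exp (-K * |z.im| / h + (C₁ * |z.im| / h + E)) := by
      rw [Real.exp_add, Real.exp_add]; ring
    _ ≤ ((2 * r : ℕ) * Λ) ^ (n + 1) * M * 1 := by
      gcongr
      exact Real.exp_le_one_iff.2 hexponent
    _ = ((2 * r : ℕ) * Λ) ^ (n + 1) * M := mul_one _
end
end

section
/- Fix ρ ∈ (0,1), K ≥ 10, C₁ ≥ 1, M > 0, and a sequence of constants (C_j)_{j∈ℕ}. Then for every N ∈ ℕ there exists C_N' > 0 such that the following holds for every h ∈ (0,1] and every ν ∈ [0,1/2], with s := 1/2 − ν + i/h. Let D ⊂ ℂ be a closed disk centered at a point x₀ ∈ [−C₁, C₁] with radius r satisfying C₁^{−1}h^ρ ≤ r ≤ min(C₁ h^ρ, 1), and set I := D ∩ ℝ. Let u be continuous on D, holomorphic on the interior of D, with |u(z)| ≤ M·e^{K|Im z|/h} for all z ∈ D. Let χ ∈ C_c^∞(ℝ) be supported in the interior of I with sup_x |χ^{(j)}(x)| ≤ C_j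 h^{−ρj} for all j ∈ ℕ. Then the semiclassical Fourier transform F_h(⟨x⟩^{2s} χ u)(ξ) := ∫_ℝ (1+x²)^s χ(x) u(x) e^{−ixξ/h} dx satisfies |F_h(⟨x⟩^{2s} χ u)(ξ)| ≤ C_N' h^N |ξ|^{−N} M for all ξ with |ξ| ≥ 3K/2. Here (1+x²)^s := exp(s·log(1+x²)) with 1+x² > 0. -/
open Complex MeasureTheory Metric Set
open scoped Real

noncomputable section


/-- `⟨x⟩ = √(1+x²)`. -/
def jap (x : ℝ) : ℝ := Real.sqrt (1 + x ^ 2)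

/-- `|x−y|_S = 2|x−y|/(⟨x⟩⟨y⟩)`: the chordal (circle) distance on `ℝ ≃ S¹ ∖ {pt}`. -/
def dS (x y : ℝ) : ℝ := 2 * |x - y| / (jap x * jap y)

/-- The measure `dP(x) = 2⟨x⟩⁻² dx` on `ℝ`. -/
def muP : Measure ℝ := (volume : Measure ℝ).withDensity fun x => ENNReal.ofReal (2 / (1 + x ^ 2))

/-- `t^w := exp(w log t)` for real `t` and complex `w` (junk value `exp 0 = 1` at `t = 0`). -/
def cpowR (t : ℝ) (w : ℂ) : ℂ := Complex.exp (w * Real.log t)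

/-- The operator `B(s)`: `(B(s)f)(x) = |Im s/(2π)|^{1/2} ∫ |x−x'|_S^{−2s} f(x') dP(x')`
(with the junk value `0` when the integral does not converge absolutely). -/
def Bop (s : ℂ) (f : ℝ → ℂ) (x : ℝ) : ℂ :=
  ((Real.sqrt (|s.im| / (2 * π)) : ℝ) : ℂ) * ∫ y, cpowR (dS x y) (-2 * s) * f y ∂muP

/-- `|γ'(x)|` for the real Möbius transformation of `g` (junk at the pole). -/
def dMobR (g : Matrix.SpecialLinearGroup (Fin 2) ℝ) (x : ℝ) : ℝ := ((g.1 1 0 * x + g.1 1 1)⁻¹) ^ 2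


/-- The part of the cone with vertex `p` and aperture `L` that lies in the disk `ball c r` and in
the half-plane `0 ≤ σ * Im z`. -/
def diskCone (c p : ℂ) (r L σ : ℝ) : Set ℂ :=
  {z | z ∈ ball c r ∧ 0 ≤ σ * z.im ∧ ‖p - z‖ ≤ L * (σ * p.im - σ * z.im)}

lemma add_smul_sub_mem_diskCone {c p z : ℂ} {r L σ t : ℝ} (hp : p ∈ ball c r)
    (hp' : 0 ≤ σ * p.im) (hz : z ∈ diskCone c p r L σ) (ht : t ∈ Icc (0 : ℝ) 1) :
    z + (t : ℂ) * (p - z) ∈ diskCone c p r L σ := by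
  obtain ⟨hz1, hz2, hz3⟩ := hz
  have h1t : 0 ≤ 1 - t := sub_nonneg.2 ht.2
  refine ⟨?_, ?_, ?_⟩
  · have := (convex_ball c r).add_smul_sub_mem hz1 hp ht
    simpa [Complex.real_smul] using this
  · have : σ * (z + (t : ℂ) * (p - z)).im = (1 - t) * (σ * z.im) + t * (σ * p.im) := by
      simp; ring
    rw [this]
    have := ht.1
    positivity
  · have e : p - (z + (t : ℂ) * (p - z)) = ((1 - t : ℝ) : ℂ) * (p - z) := by
      push_cast; ring
    rw [e, norm_mul, Complex.norm_real, Real.norm_of_nonneg h1t]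
    calc (1 - t) * ‖p - z‖ ≤ (1 - t) * (L * (σ * p.im - σ * z.im)) := by gcongr
      _ = _ := by simp; ring

/-- On a disk, a holomorphic function with exponential decay in a cone has a primitive with the same
decay, gaining a factor `L / a`. -/
lemma exists_primitive_exp_decay {c p : ℂ} {r L σ a B : ℝ} (hp : p ∈ ball c r)
    (hp' : 0 ≤ σ * p.im) (hL : 0 ≤ L) (ha : 0 < a) (hB : 0 ≤ B) {f : ℂ → ℂ}
    (hf : DifferentiableOn ℂ f (ball c r))
    (hb : ∀ z ∈ diskCone c p r L σ, ‖f z‖ ≤ B * Real.exp (-(a * (σ * z.im)))) :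
    ∃ F : ℂ → ℂ, (∀ z ∈ ball c r, HasDerivAt F (f z) z) ∧
      ∀ z ∈ diskCone c p r L σ, ‖F z‖ ≤ B * (L / a) * Real.exp (-(a * (σ * z.im))) := by
  obtain ⟨F, hFp, hF⟩ := hf.isExactOn_ball.with_val_at p 0
  refine ⟨F, hF, fun z hz => ?_⟩
  set y := σ * z.im with hy
  set d := σ * p.im - σ * z.im with hd
  have hγ : ∀ t ∈ Icc (0 : ℝ) 1, z + (t : ℂ) * (p - z) ∈ diskCone c p r L σ :=
    fun t ht => add_smul_sub_mem_diskCone hp hp' hz ht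
  have hderiv : ∀ t ∈ Icc (0 : ℝ) 1, HasDerivAt (fun t : ℝ => F (z + (t : ℂ) * (p - z)) - F z)
      (f (z + (t : ℂ) * (p - z)) * (p - z)) t := by
    intro t ht
    have h1 : HasDerivAt (fun t : ℝ => z + (t : ℂ) * (p - z)) (p - z) t := by
      simpa using ((Complex.ofRealCLM.hasDerivAt (x := t)).mul_const (p - z)).const_add z
    exact ((hF _ (hγ t ht).1).comp t h1).sub_const _
  have hbd : ∀ t : ℝ, HasDerivAt
      (fun t : ℝ => B * (L / a) * (Real.exp (-(a * y)) - Real.exp (-(a * (y + t * d)))))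
      (B * L * d * Real.exp (-(a * (y + t * d)))) t := by
    intro t
    have h1 : HasDerivAt (fun t : ℝ => -(a * (y + t * d))) (-(a * d)) t := by
      simpa using ((((hasDerivAt_id t).mul_const d).const_add y).const_mul a).fun_neg
    convert! (h1.exp.const_sub (Real.exp (-(a * y)))).const_mul (B * (L / a)) using 1
    field_simp
  have key := image_norm_le_of_norm_deriv_right_le_deriv_boundary
    (fun t ht => (hderiv t ht).continuousAt.continuousWithinAt)
    (fun t ht => (hderiv t (Ico_subset_Icc_self ht)).hasDerivWithinAt)
    (by simp) hbd (fun t ht => ?_) (right_mem_Icc.2 zero_le_one)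
  · simp only [ofReal_one, one_mul, add_sub_cancel, hFp, zero_sub, norm_neg] at key
    refine key.trans ?_
    gcongr
    linarith [Real.exp_pos (-(a * (y + d)))]
  · have ht' := Ico_subset_Icc_self ht
    have e : σ * (z + (t : ℂ) * (p - z)).im = y + t * d := by
      simp [hy, hd]; ring
    have := hb _ (hγ t ht')
    rw [e] at this
    rw [norm_mul]
    calc _ ≤ B * Real.exp (-(a * (y + t * d))) * (L * d) :=
          mul_le_mul this hz.2.2 (norm_nonneg _) (by positivity)
      _ = _ := by ring

/-- Integration by parts against a test function supported in the real trace of a disk. -/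
lemma integral_mul_eq_neg_integral_deriv_mul {x₀ r : ℝ} {f F : ℂ → ℂ} {φ : ℝ → ℝ}
    (hF : ∀ z ∈ ball (x₀ : ℂ) r, HasDerivAt F (f z) z) (hf : ContinuousOn f (ball (x₀ : ℂ) r))
    (hφ : ContDiff ℝ 1 φ) (hc : HasCompactSupport φ) (hs : tsupport φ ⊆ Ioo (x₀ - r) (x₀ + r)) :
    ∫ x : ℝ, (φ x : ℂ) * f x = -∫ x : ℝ, ((deriv φ x : ℝ) : ℂ) * F x := by
  have hmem : ∀ x ∈ Ioo (x₀ - r) (x₀ + r), (x : ℂ) ∈ ball (x₀ : ℂ) r := by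
    intro x hx
    rw [mem_ball, Complex.dist_eq, ← ofReal_sub, Complex.norm_real, Real.norm_eq_abs, abs_lt]
    constructor <;> linarith [hx.1, hx.2]
  have hprod : ∀ (g : ℂ → ℂ) (ψ : ℝ → ℝ), ContinuousOn g (ball (x₀ : ℂ) r) → Continuous ψ →
      tsupport ψ ⊆ tsupport φ → Continuous (fun x : ℝ => (ψ x : ℂ) * g x) ∧
        HasCompactSupport (fun x : ℝ => (ψ x : ℂ) * g x) := by
    intro g ψ hg hψ hsψ
    have hts : tsupport (fun x : ℝ => (ψ x : ℂ) * g x) ⊆ tsupport ψ := by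
      refine closure_mono fun x hx => ?_
      contrapose! hx
      simp_all
    refine ⟨continuous_of_tsupport fun x hx => ?_, ?_⟩
    · have hx' := hmem x (hs (hsψ (hts hx)))
      have : ContinuousAt (fun x : ℝ => g (x : ℂ)) x :=
        ContinuousAt.comp (f := fun x : ℝ => (x : ℂ)) (hg.continuousAt (isOpen_ball.mem_nhds hx'))
          Complex.continuous_ofReal.continuousAt
      exact (Complex.continuous_ofReal.comp hψ).continuousAt.mul this
    · exact hc.of_isClosed_subset (isClosed_tsupport _) (hts.trans hsψ)
  have hFc : ContinuousOn F (ball (x₀ : ℂ) r) :=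
    fun z hz => (hF z hz).continuousAt.continuousWithinAt
  have hφ' : Continuous (deriv φ) := hφ.continuous_deriv le_rfl
  have h0 := hprod F φ hFc hφ.continuous le_rfl
  have h1 := hprod F (deriv φ) hFc hφ' tsupport_deriv_subset
  have h2 := hprod f φ hf hφ.continuous le_rfl
  have i1 := h1.1.integrable_of_hasCompactSupport (μ := volume) h1.2
  have i2 := h2.1.integrable_of_hasCompactSupport (μ := volume) h2.2
  have hd : ∀ x : ℝ, HasDerivAt (fun x : ℝ => (φ x : ℂ) * F x)
      (((deriv φ x : ℝ) : ℂ) * F x + (φ x : ℂ) * f x) x := by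
    intro x
    by_cases hx : x ∈ tsupport φ
    · exact (hφ.differentiable one_ne_zero x).hasDerivAt.ofReal_comp.mul
        (hF _ (hmem x (hs hx))).comp_ofReal
    · have hev : φ =ᶠ[nhds x] 0 := notMem_tsupport_iff_eventuallyEq.1 hx
      have e1 : φ x = 0 := hev.eq_of_nhds
      have e2 : deriv φ x = 0 := by rw [hev.deriv_eq]; simp
      rw [e1, e2]
      simp only [ofReal_zero, zero_mul, add_zero]
      refine (hasDerivAt_const x (0 : ℂ)).congr_of_eventuallyEq ?_
      filter_upwards [hev] with t ht
      simp [ht]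
  have := integral_eq_zero_of_hasDerivAt_of_integrable hd (i1.add i2)
    (h0.1.integrable_of_hasCompactSupport h0.2)
  rw [integral_add i1 i2] at this
  exact eq_neg_of_add_eq_zero_right this

lemma tsupport_iteratedDeriv_subset (φ : ℝ → ℝ) (n : ℕ) :
    tsupport (iteratedDeriv n φ) ⊆ tsupport φ := by
  induction n with
  | zero => simp
  | succ n ih =>
    rw [iteratedDeriv_succ]
    exact tsupport_deriv_subset.trans ih

lemma exists_integral_mul_eq_integral_iteratedDeriv_mul {x₀ r L σ a B : ℝ} {p : ℂ}
    (hp : p ∈ ball (x₀ : ℂ) r) (hp' : 0 ≤ σ * p.im) (hL : 0 ≤ L) (ha : 0 < a) (hB : 0 ≤ B)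
    {f : ℂ → ℂ} (hf : DifferentiableOn ℂ f (ball (x₀ : ℂ) r))
    (hb : ∀ z ∈ diskCone x₀ p r L σ, ‖f z‖ ≤ B * Real.exp (-(a * (σ * z.im))))
    {χ : ℝ → ℝ} (hχ : ContDiff ℝ (⊤ : ℕ∞) χ) (hc : HasCompactSupport χ)
    (hs : tsupport χ ⊆ Ioo (x₀ - r) (x₀ + r)) (n : ℕ) :
    ∃ F : ℂ → ℂ, DifferentiableOn ℂ F (ball (x₀ : ℂ) r) ∧
      (∀ z ∈ diskCone x₀ p r L σ, ‖F z‖ ≤ B * (L / a) ^ n * Real.exp (-(a * (σ * z.im)))) ∧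
      ∫ x : ℝ, (χ x : ℂ) * f x =
        (-1) ^ n * ∫ x : ℝ, ((iteratedDeriv n χ x : ℝ) : ℂ) * F x := by
  induction n with
  | zero => exact ⟨f, hf, by simpa using hb, by simp⟩
  | succ n ih =>
    obtain ⟨F, hF, hFb, hint⟩ := ih
    obtain ⟨G, hG, hGb⟩ := exists_primitive_exp_decay hp hp' hL ha (by positivity) hF hFb
    have hts := tsupport_iteratedDeriv_subset χ n
    refine ⟨G, fun z hz => (hG z hz).differentiableAt.differentiableWithinAt, ?_, ?_⟩
    · intro z hz
      rw [pow_succ, ← mul_assoc]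
      exact hGb z hz
    · have hsm : ContDiff ℝ 1 (iteratedDeriv n χ) := by
        rw [iteratedDeriv_eq_iterate]
        exact (hχ.iterate_deriv n).of_le (by exact_mod_cast le_top)
      rw [hint, integral_mul_eq_neg_integral_deriv_mul hG hF.continuousOn hsm
        (hc.of_isClosed_subset (isClosed_tsupport _) hts) (hts.trans hs), iteratedDeriv_succ]
      ring

lemma abs_arg_le_div {w : ℂ} (hw : 0 < w.re) : |w.arg| ≤ |w.im| / w.re := by
  have h := abs_arg_lt_pi_div_two_iff.2 (Or.inl hw)
  rw [abs_lt] at h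
  have ht := tan_arg w
  rw [← abs_of_pos hw, ← abs_div, ← ht]
  rcases le_total 0 w.arg with h0 | h0
  · rw [abs_of_nonneg h0]
    exact (Real.le_tan h0 h.2).trans (le_abs_self _)
  · rw [abs_of_nonpos h0]
    refine (Real.le_tan (neg_nonneg.2 h0) (by linarith)).trans ?_
    rw [Real.tan_neg]
    exact neg_le_abs _

lemma norm_exp_mul_log_one_add_sq_le {z : ℂ} {A h ν : ℝ} (hh : 0 < h)
    (hν : ν ∈ Icc (0 : ℝ) (1 / 2)) (hA : 1 ≤ A) (hz : ‖1 + z ^ 2‖ ≤ A) (him : |z.im| ≤ 1 / 2) :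
    ‖Complex.exp ((1 / 2 - ν + I / h) * Complex.log (1 + z ^ 2))‖ ≤
      A * Real.exp (2 * |z.im| / h) := by
  have hre : (1 + z ^ 2).re = 1 + z.re ^ 2 - z.im ^ 2 := by simp [sq]; ring
  have him' : (1 + z ^ 2).im = 2 * z.re * z.im := by simp [sq]; ring
  have hsq : z.im ^ 2 ≤ 1 / 4 := by
    rw [← sq_abs]; nlinarith [abs_nonneg z.im]
  have hpos : 0 < (1 + z ^ 2).re := by rw [hre]; nlinarith [sq_nonneg z.re]
  have harg : |(1 + z ^ 2).arg| ≤ 2 * |z.im| := by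
    refine (abs_arg_le_div hpos).trans ?_
    rw [div_le_iff₀ hpos, him', hre, abs_mul, abs_mul, abs_two]
    have : |z.re| ≤ 1 + z.re ^ 2 - z.im ^ 2 := by
      rw [← sq_abs z.re]; nlinarith [sq_nonneg (|z.re| - 1 / 2)]
    nlinarith [abs_nonneg z.im]
  have hne : 0 < ‖1 + z ^ 2‖ := by
    rw [norm_pos_iff]; rintro h0; simp [h0] at hpos
  have e : ((1 / 2 - ν + I / h) * Complex.log (1 + z ^ 2)).re =
      (1 / 2 - ν) * Real.log ‖1 + z ^ 2‖ - (1 + z ^ 2).arg / h := by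
    have : (1 / 2 - ν + I / h : ℂ) = ((1 / 2 - ν : ℝ) : ℂ) + ((1 / h : ℝ) : ℂ) * I := by
      push_cast; ring
    rw [this, mul_re]
    simp only [add_re, add_im, ofReal_re, ofReal_im, re_ofReal_mul, im_ofReal_mul, I_re, I_im,
      log_re, log_im]
    ring
  rw [Complex.norm_exp, e, sub_eq_add_neg, Real.exp_add]
  have hlog : Real.log ‖1 + z ^ 2‖ ≤ Real.log A := Real.log_le_log hne hz
  have hlogA : 0 ≤ Real.log A := Real.log_nonneg hA
  gcongr
  · rw [← Real.le_log_iff_exp_le (by linarith)]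
    nlinarith [hν.1, hν.2]
  · rw [← neg_div]
    gcongr
    exact (neg_le_abs _).trans harg

/-- If `u` is holomorphic on an `h^ρ`-sized disk `D` centered on the real
axis, bounded by `M e^{K|Im z|/h}`, and `χ` is a cutoff supported in `I = D ∩ ℝ` with
derivative bounds `|χ^{(j)}| ≤ C_j h^{−ρj}`, then the semiclassical Fourier transform of
`⟨x⟩^{2s} χ u` is `O(h^N |ξ|^{−N} M)` for `|ξ| ≥ 3K/2`. -/
theorem stmt13 (ρ K C₁ M : ℝ) (Cj : ℕ → ℝ)
    (hρ : ρ ∈ Set.Ioo (0 : ℝ) 1) (hK : 10 ≤ K) (hC₁ : 1 ≤ C₁) (hM : 0 < M) :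
    ∀ N : ℕ, ∃ C' > 0, ∀ h ∈ Set.Ioc (0 : ℝ) 1, ∀ ν ∈ Set.Icc (0 : ℝ) (1 / 2),
    ∀ x₀ rad : ℝ, x₀ ∈ Set.Icc (-C₁) C₁ → C₁⁻¹ * h ^ ρ ≤ rad → rad ≤ min (C₁ * h ^ ρ) 1 →
    ∀ u : ℂ → ℂ, ContinuousOn u (closedBall ((x₀ : ℝ) : ℂ) rad) →
      DifferentiableOn ℂ u (ball ((x₀ : ℝ) : ℂ) rad) →
      (∀ z ∈ closedBall ((x₀ : ℝ) : ℂ) rad, ‖u z‖ ≤ M * Real.exp (K * |z.im| / h)) →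
    ∀ χ : ℝ → ℝ, ContDiff ℝ (⊤ : ℕ∞) χ → HasCompactSupport χ →
      tsupport χ ⊆ Set.Ioo (x₀ - rad) (x₀ + rad) →
      (∀ (j : ℕ) (x : ℝ), |iteratedDeriv j χ x| ≤ Cj j * h ^ (-(ρ * j))) →
    ∀ ξ : ℝ, 3 * K / 2 ≤ |ξ| →
      ‖∫ x : ℝ, cpowR (1 + x ^ 2) (1 / 2 - ν + I / h) * (χ x : ℂ) * u ((x : ℝ) : ℂ) *
          Complex.exp (-(I * x * ξ) / h)‖ ≤ C' * h ^ (N : ℝ) * |ξ| ^ (-(N : ℝ)) * M := by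
  intro N
  have hρ1 : 0 < 1 - ρ := sub_pos.2 hρ.2
  obtain ⟨n, hn⟩ := exists_nat_ge ((N : ℝ) / (1 - ρ))
  rw [div_le_iff₀ hρ1] at hn
  have hNn : (N : ℝ) ≤ n := hn.trans (by nlinarith [hρ.1, n.cast_nonneg (α := ℝ)])
  set A : ℝ := 1 + (C₁ + 1) ^ 2 with hA
  have hA1 : 1 ≤ A := by rw [hA]; nlinarith [sq_nonneg (C₁ + 1)]
  refine ⟨2 * (|Cj n| + 1) * A * 15 ^ n, by positivity, ?_⟩
  intro h hh ν hν x₀ rad hx₀ hrad1 hrad2 u huc hud hub χ hχ hχc hχs hχb ξ hξ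
  have hh0 : 0 < h := hh.1
  have hrad : 0 < rad := lt_of_lt_of_le (by positivity) hrad1
  have hrad' : rad ≤ 1 := hrad2.trans (min_le_right _ _)
  have hξ1 : 15 ≤ |ξ| := by linarith
  have hξ0 : 0 < |ξ| := by linarith
  obtain ⟨σ, hσ, hσξ⟩ : ∃ σ : ℝ, σ * σ = 1 ∧ σ * ξ = -|ξ| := by
    rcases le_total 0 ξ with h0 | h0
    · exact ⟨-1, by norm_num, by rw [abs_of_nonneg h0]; ring⟩
    · exact ⟨1, by norm_num, by rw [abs_of_nonpos h0]; ring⟩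
  have hσ1 : |σ| = 1 := by
    rcases mul_self_eq_one_iff.1 hσ with h0 | h0 <;> simp [h0]
  set p : ℂ := x₀ + ((σ * (rad / 2) : ℝ) : ℂ) * I with hp
  have hpim : σ * p.im = rad / 2 := by
    simp [hp, ← mul_assoc, hσ]
  have hpn : ‖p - x₀‖ = rad / 2 := by
    rw [hp, add_sub_cancel_left, norm_mul, Complex.norm_I, mul_one, Complex.norm_real,
      Real.norm_eq_abs, abs_mul, hσ1, one_mul, abs_of_pos (by positivity)]
  have hpb : p ∈ ball (x₀ : ℂ) rad := by
    rw [mem_ball, Complex.dist_eq, hpn]; linarith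
  have hbn : ∀ z ∈ ball (x₀ : ℂ) rad, ‖1 + z ^ 2‖ ≤ A ∧ z.im ^ 2 < 1 := by
    intro z hz
    rw [mem_ball, Complex.dist_eq] at hz
    constructor
    · have h1 : ‖z‖ ≤ C₁ + 1 := by
        calc ‖z‖ = ‖(x₀ : ℂ) + (z - x₀)‖ := by congr 1; ring
          _ ≤ ‖(x₀ : ℂ)‖ + ‖z - x₀‖ := norm_add_le _ _
          _ ≤ C₁ + 1 := by
            rw [Complex.norm_real, Real.norm_eq_abs]
            exact add_le_add (abs_le.2 hx₀) (by linarith)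
      calc ‖1 + z ^ 2‖ ≤ ‖(1 : ℂ)‖ + ‖z ^ 2‖ := norm_add_le _ _
        _ ≤ A := by rw [norm_one, norm_pow, hA]; gcongr
    · have h1 := Complex.abs_im_le_norm (z - x₀)
      simp only [sub_im, ofReal_im, sub_zero] at h1
      rw [← sq_abs]
      nlinarith [abs_nonneg z.im]
  set f : ℂ → ℂ := fun z => Complex.exp ((1 / 2 - ν + I / h) * Complex.log (1 + z ^ 2)) * u z *
    Complex.exp (-(I * z * ξ) / h) with hf
  have hfd : DifferentiableOn ℂ f (ball (x₀ : ℂ) rad) := by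
    have hslit : ∀ z ∈ ball (x₀ : ℂ) rad, 1 + z ^ 2 ∈ slitPlane := by
      intro z hz
      refine Or.inl ?_
      have hre : (1 + z ^ 2).re = 1 + z.re ^ 2 - z.im ^ 2 := by simp [sq]; ring
      rw [hre]
      nlinarith [sq_nonneg z.re, (hbn z hz).2]
    have hl : DifferentiableOn ℂ (fun z : ℂ => Complex.log (1 + z ^ 2)) (ball (x₀ : ℂ) rad) :=
      DifferentiableOn.clog (by fun_prop) hslit
    exact ((hl.const_mul _).cexp.mul hud).mul (by fun_prop)
  have hfb : ∀ z ∈ diskCone x₀ p rad 3 σ,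
      ‖f z‖ ≤ A * M * Real.exp (-(|ξ| / (5 * h) * (σ * z.im))) := by
    intro z ⟨hz, hz0, hz1⟩
    have hyσ : σ * z.im = |z.im| := by
      rw [← abs_of_nonneg hz0, abs_mul, hσ1, one_mul]
    rw [hpim, hyσ] at hz1
    have hy : |z.im| ≤ 1 / 2 := by linarith [norm_nonneg (p - z)]
    have hyξ : z.im * ξ = -(|ξ| * |z.im|) := by
      calc z.im * ξ = (σ * z.im) * (σ * ξ) := by
            rw [mul_mul_mul_comm, hσ, one_mul]
        _ = _ := by rw [hyσ, hσξ]; ring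
    have h3 : ‖Complex.exp (-(I * z * ξ) / h)‖ = Real.exp (-(|ξ| * |z.im|) / h) := by
      have : (-(I * z * ξ) / h : ℂ) = ((ξ / h : ℝ) : ℂ) * (-(I * z)) := by push_cast; ring
      rw [Complex.norm_exp, this, re_ofReal_mul, ← hyξ]
      congr 1
      simp; ring
    have h1 := norm_exp_mul_log_one_add_sq_le hh0 hν hA1 (hbn z hz).1 hy
    have h2 := hub z (ball_subset_closedBall hz)
    rw [hf, norm_mul, norm_mul, h3, hyσ]
    calc _ ≤ A * Real.exp (2 * |z.im| / h) * (M * Real.exp (K * |z.im| / h)) *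
          Real.exp (-(|ξ| * |z.im|) / h) := by gcongr
      _ = A * M * Real.exp (((2 + K - |ξ|) * |z.im|) / h) := by
        have e : ((2 + K - |ξ|) * |z.im|) / h =
          2 * |z.im| / h + K * |z.im| / h + -(|ξ| * |z.im|) / h := by ring
        rw [e, Real.exp_add, Real.exp_add]; ring
      _ ≤ _ := by
        have e : -(|ξ| / (5 * h) * |z.im|) = (-(|ξ| / 5) * |z.im|) / h := by
          field_simp
        rw [e]
        gcongr
        linarith
  obtain ⟨F, -, hFb, hint⟩ := exists_integral_mul_eq_integral_iteratedDeriv_mul hpb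
    (hpim ▸ by positivity) (by norm_num) (by positivity : 0 < |ξ| / (5 * h)) (by positivity)
    hfd hfb hχ hχc hχs n
  have heq : ∀ x : ℝ, cpowR (1 + x ^ 2) (1 / 2 - ν + I / h) * (χ x : ℂ) * u ((x : ℝ) : ℂ) *
      Complex.exp (-(I * x * ξ) / h) = (χ x : ℂ) * f x := by
    intro x
    rw [cpowR, ofReal_log (by positivity), hf]
    push_cast
    ring
  simp_rw [heq]
  rw [hint, norm_mul, norm_pow, norm_neg, norm_one, one_pow, one_mul]
  have hsupp : ∀ x ∉ Ioo (x₀ - rad) (x₀ + rad), ((iteratedDeriv n χ x : ℝ) : ℂ) * F x = 0 := by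
    intro x hx
    rw [image_eq_zero_of_notMem_tsupport
      fun hx' => hx (hχs (tsupport_iteratedDeriv_subset χ n hx'))]
    simp
  have hbound : ∀ x ∈ Ioo (x₀ - rad) (x₀ + rad), ‖((iteratedDeriv n χ x : ℝ) : ℂ) * F x‖ ≤
      ((|Cj n| + 1) * h ^ (-(ρ * n))) * (A * M * (3 / (|ξ| / (5 * h))) ^ n) := by
    intro x hx
    have hx' : |x - x₀| < rad := abs_lt.2 ⟨by linarith [hx.1], by linarith [hx.2]⟩
    have hxn : ‖(x : ℂ) - x₀‖ < rad := by
      rwa [← ofReal_sub, Complex.norm_real, Real.norm_eq_abs]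
    have hxc : (x : ℂ) ∈ diskCone x₀ p rad 3 σ := by
      refine ⟨by rwa [mem_ball, Complex.dist_eq], by simp, ?_⟩
      rw [hpim, ofReal_im, mul_zero, sub_zero]
      linarith [norm_sub_le_norm_sub_add_norm_sub p x₀ x, norm_sub_rev (x₀ : ℂ) x]
    have hFx := hFb x hxc
    simp only [ofReal_im, mul_zero, neg_zero, Real.exp_zero, mul_one] at hFx
    rw [norm_mul, Complex.norm_real, Real.norm_eq_abs]
    refine mul_le_mul ((hχb n x).trans ?_) hFx (norm_nonneg _) (by positivity)
    gcongr
    linarith [le_abs_self (Cj n)]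
  rw [← setIntegral_eq_integral_of_forall_compl_eq_zero hsupp]
  refine (norm_setIntegral_le_of_norm_le_const (by simp) hbound).trans ?_
  have hvol : (volume : Measure ℝ).real (Ioo (x₀ - rad) (x₀ + rad)) ≤ 2 := by
    rw [Real.volume_real_Ioo_of_le (by linarith)]; linarith
  have hpow : h ^ (-(ρ * n)) * (3 / (|ξ| / (5 * h))) ^ n ≤
      15 ^ n * (h ^ (N : ℝ) * |ξ| ^ (-(N : ℝ))) := by
    have e : (3 / (|ξ| / (5 * h))) ^ n = 15 ^ n * (h ^ (n : ℝ) * |ξ| ^ (-(n : ℝ))) := by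
      rw [Real.rpow_neg hξ0.le, Real.rpow_natCast, Real.rpow_natCast, ← inv_pow, ← mul_pow,
        ← mul_pow]
      congr 1
      field_simp
      norm_num
    calc h ^ (-(ρ * n)) * (3 / (|ξ| / (5 * h))) ^ n
        = 15 ^ n * (h ^ (-(ρ * n) + (n : ℝ)) * |ξ| ^ (-(n : ℝ))) := by
          rw [e, Real.rpow_add hh0]; ring
      _ ≤ 15 ^ n * (h ^ (N : ℝ) * |ξ| ^ (-(N : ℝ))) := by
        gcongr ?_ * (?_ * ?_)
        · exact Real.rpow_le_rpow_of_exponent_ge hh0 hh.2 (by linarith)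
        · exact Real.rpow_le_rpow_of_exponent_le (by linarith) (by linarith)
  calc _ ≤ (|Cj n| + 1) * h ^ (-(ρ * n)) * (A * M * (3 / (|ξ| / (5 * h))) ^ n) * 2 := by gcongr
    _ = 2 * (|Cj n| + 1) * A * M * (h ^ (-(ρ * n)) * (3 / (|ξ| / (5 * h))) ^ n) := by ring
    _ ≤ 2 * (|Cj n| + 1) * A * M * (15 ^ n * (h ^ (N : ℝ) * |ξ| ^ (-(N : ℝ)))) := by gcongr
    _ = _ := by ring
end
end
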